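/- Theorem 2 (Gaptron mistake bound for the multiclass hinge loss, full information): Let K ≥ 2, d ≥ 1, X > 0, D > 0, β = 1/K and η = (1−β)/(KX²) = (K−1)/(K²X²). Given x_1,…,x_T ∈ ℝ^d with ‖x_t‖ ≤ X and y_1,…,y_T ∈ {1,…,K}, define W_1 = 0 and W_{t+1} = Π_D(W_t − η g_t), where: y_t⋆ is any label maximizing k ↦ ⟨W_t^k, x_t⟩; k̃_t is any label maximizing k ↦ ⟨W_t^k, x_t⟩ over k ≠ y_t; m_t(W,y) = ⟨W^y,x_t⟩ − max_{k≠y}⟨W^k,x_t⟩; m_t⋆ = max_k m_t(W_t,k); g_t = (e_{k̃_t} − e_{y_t}) ⊗ x_t if m_t⋆ ≤ β or y_t⋆ ≠ y_t, and g_t = 0 if y_t⋆ = y_t and m_t⋆ > β. Let a_t = 1 − max{1[m_t⋆ > β], m_t⋆} and define the hinge loss ℓ_t(W) = 0 if y_t⋆ = y_t and m_t⋆ > β, and ℓ_t(W) = max{1 − m_t(W,y_t), 0} otherwise. Then for every U ∈ ℝ^{K×d} with ‖U‖ ≤ D: Σ_{t=1}^T [(1 − max{a_t,0})·1[y_t⋆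 ≠ y_t] + max{a_t,0}·(K−1)/K] ≤ Σ_{t=1}^T ℓ_t(U) + K²X²‖U‖²/(2(K−1)). -/

import Mathlib

open scoped RealInnerProductSpace BigOperators

/-- Frobenius norm of a `K × d` matrix given by its rows. -/
noncomputable def frob {K d : ℕ} (W : Fin K → EuclideanSpace ℝ (Fin d)) : ℝ :=
  Real.sqrt (∑ k, ‖W k‖ ^ 2)

/-- Euclidean (Frobenius) projection onto the ball of radius `D`. -/
noncomputable def projM {K d : ℕ} (D : ℝ) (V : Fin K → EuclideanSpace ℝ (Fin d)) :
    Fin K → EuclideanSpace ℝ (Fin d) :=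
  if frob V ≤ D then V else fun k => (D / frob V) • V k

/-- Margin `m(W, x, y) = ⟨W^y, x⟩ − max_{k ≠ y} ⟨W^k, x⟩`. -/
noncomputable def margin {K d : ℕ} (W : Fin K → EuclideanSpace ℝ (Fin d))
    (x : EuclideanSpace ℝ (Fin d)) (y : Fin K) : ℝ :=
  ⟪W y, x⟫ - ⨆ k : {k : Fin K // k ≠ y}, ⟪W k.1, x⟫


lemma aux_proj {E : Type*} [NormedAddCommGroup E] [InnerProductSpace ℝ E] (D : ℝ) (hD : 0 < D)
    (V U : E) (hU : ‖U‖ ≤ D) (hV : D < ‖V‖) :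
    ‖(D / ‖V‖) • V - U‖ ^ 2 ≤ ‖V - U‖ ^ 2 := by
  have hN : 0 < ‖V‖ := hD.trans hV
  have hc : D / ‖V‖ * ‖V‖ = D := by field_simp
  have hc0 : 0 < D / ‖V‖ := by positivity
  have hc1 : D / ‖V‖ < 1 := by rw [div_lt_one hN]; exact hV
  have hcs : ⟪V, U⟫ ≤ ‖V‖ * D :=
    (real_inner_le_norm V U).trans (mul_le_mul_of_nonneg_left hU hN.le)
  rw [norm_sub_sq_real, norm_sub_sq_real, norm_smul, Real.norm_of_nonneg hc0.le, hc,
    real_inner_smul_left]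
  generalize D / ‖V‖ = c at *
  have h1 : (1 - c) * ⟪V, U⟫ ≤ (1 - c) * (‖V‖ * D) :=
    mul_le_mul_of_nonneg_left hcs (by linarith)
  have h2 : (1 - c) * (‖V‖ * D) = ‖V‖ * D - D ^ 2 := by rw [← hc]; ring
  nlinarith [sq_nonneg (‖V‖ - D)]

lemma frob_sq {K d : ℕ} (V : Fin K → EuclideanSpace ℝ (Fin d)) :
    frob V ^ 2 = ∑ k, ‖V k‖ ^ 2 := by
  unfold frob
  exact Real.sq_sqrt (Finset.sum_nonneg fun _ _ => sq_nonneg _)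

lemma frob_eq {K d : ℕ} (V : Fin K → EuclideanSpace ℝ (Fin d)) :
    frob V = ‖(WithLp.toLp 2 V : PiLp 2 (fun _ : Fin K => EuclideanSpace ℝ (Fin d)))‖ := by
  rw [PiLp.norm_eq_of_L2]; rfl

lemma projM_le {K d : ℕ} (D : ℝ) (hD : 0 < D) (V U : Fin K → EuclideanSpace ℝ (Fin d))
    (hU : frob U ≤ D) :
    ∑ k, ‖projM D V k - U k‖ ^ 2 ≤ ∑ k, ‖V k - U k‖ ^ 2 := by
  unfold projM
  split_ifs with h
  · exact le_rfl
  · rw [not_le] at h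
    rw [frob_eq] at *
    have := aux_proj D hD (WithLp.toLp 2 V : PiLp 2 (fun _ : Fin K => EuclideanSpace ℝ (Fin d)))
      (WithLp.toLp 2 U) hU h
    rw [PiLp.norm_sq_eq_of_L2, PiLp.norm_sq_eq_of_L2] at this
    exact this

lemma margin_le {K d : ℕ} (W : Fin K → EuclideanSpace ℝ (Fin d))
    (x : EuclideanSpace ℝ (Fin d)) (y k : Fin K) (h : k ≠ y) :
    margin W x y ≤ ⟪W y, x⟫ - ⟪W k, x⟫ := by
  unfold margin
  have := le_ciSup (f := fun k : {k : Fin K // k ≠ y} => ⟪W k.1, x⟫)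
    (Set.finite_range _).bddAbove ⟨k, h⟩
  simp only at this
  linarith

lemma le_margin {K d : ℕ} (W : Fin K → EuclideanSpace ℝ (Fin d))
    (x : EuclideanSpace ℝ (Fin d)) (y k : Fin K) (h : k ≠ y) (c : ℝ)
    (hc : ∀ j, j ≠ y → ⟪W j, x⟫ ≤ c) :
    ⟪W y, x⟫ - c ≤ margin W x y := by
  unfold margin
  have : Nonempty {k : Fin K // k ≠ y} := ⟨⟨k, h⟩⟩
  have := ciSup_le (f := fun k : {k : Fin K // k ≠ y} => ⟪W k.1, x⟫) (fun j => hc j.1 j.2)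
  linarith

lemma upd_sq {K d : ℕ} (V U : Fin K → EuclideanSpace ℝ (Fin d)) (x : EuclideanSpace ℝ (Fin d))
    (η : ℝ) (i j : Fin K) (hij : i ≠ j) :
    ∑ k, ‖(V k - η • (((if k = i then (1 : ℝ) else 0) - if k = j then 1 else 0) • x)) - U k‖ ^ 2
     = ∑ k, ‖V k - U k‖ ^ 2 - 2 * η * ((⟪V i, x⟫ - ⟪U i, x⟫) - (⟪V j, x⟫ - ⟪U j, x⟫))
       + 2 * η ^ 2 * ‖x‖ ^ 2 := by
  have key : ∀ k, ‖(V k - η • (((if k = i then (1 : ℝ) else 0) - if k = j then 1 else 0) • x))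
      - U k‖ ^ 2 = ‖V k - U k‖ ^ 2
      + (if k = i then - 2 * η * (⟪V k, x⟫ - ⟪U k, x⟫) + η ^ 2 * ‖x‖ ^ 2 else 0)
      + (if k = j then 2 * η * (⟪V k, x⟫ - ⟪U k, x⟫) + η ^ 2 * ‖x‖ ^ 2 else 0) := by
    intro k
    have e : (V k - η • (((if k = i then (1 : ℝ) else 0) - if k = j then 1 else 0) • x)) - U k
      = (V k - U k) - (η * ((if k = i then (1 : ℝ) else 0) - if k = j then 1 else 0)) • x := by
      rw [smul_smul]; abel
    rw [e, norm_sub_sq_real, inner_smul_right, norm_smul, mul_pow, Real.norm_eq_abs, sq_abs,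
      inner_sub_left]
    by_cases h1 : k = i
    · have h2 : k ≠ j := h1 ▸ hij
      rw [if_pos h1, if_pos h1, if_neg h2, if_neg h2]; ring
    · by_cases h2 : k = j
      · rw [if_neg h1, if_neg h1, if_pos h2, if_pos h2]; ring
      · rw [if_neg h1, if_neg h1, if_neg h2, if_neg h2]; ring
  rw [Finset.sum_congr rfl fun k _ => key k, Finset.sum_add_distrib, Finset.sum_add_distrib]
  simp only [Finset.sum_ite_eq', Finset.mem_univ, if_true]
  ring

/-- Theorem 2: Gaptron mistake bound for the multiclass hinge loss (full information). -/
theorem gaptron_hinge_full_info (K d T : ℕ) (hK : 2 ≤ K) (hd : 1 ≤ d)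
    (X D : ℝ) (hX : 0 < X) (hD : 0 < D)
    (β η : ℝ) (hβ : β = 1 / K) (hη : η = (1 - β) / (K * X ^ 2))
    (x : Fin T → EuclideanSpace ℝ (Fin d)) (hx : ∀ t, ‖x t‖ ≤ X)
    (y : Fin T → Fin K)
    (W : ℕ → Fin K → EuclideanSpace ℝ (Fin d))
    (ystar : Fin T → Fin K)
    (hystar : ∀ t : Fin T, ∀ k, ⟪W t.1 k, x t⟫ ≤ ⟪W t.1 (ystar t), x t⟫)
    (ktil : Fin T → Fin K)
    (hktil : ∀ t : Fin T, ktil t ≠ y t ∧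
      ∀ k, k ≠ y t → ⟪W t.1 k, x t⟫ ≤ ⟪W t.1 (ktil t), x t⟫)
    (mstar : Fin T → ℝ)
    (hmstar : ∀ t : Fin T, mstar t = ⨆ k, margin (W t.1) (x t) k)
    (g : Fin T → Fin K → EuclideanSpace ℝ (Fin d))
    (hg : ∀ t : Fin T, g t =
      if mstar t ≤ β ∨ ystar t ≠ y t then
        (fun k => ((if k = ktil t then (1 : ℝ) else 0) - if k = y t then 1 else 0) • x t)
      else 0)
    (hW0 : W 0 = 0)
    (hWsucc : ∀ t : Fin T, W (t.1 + 1) = projM D (fun k => W t.1 k - η • g t k))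
    (a : Fin T → ℝ)
    (ha : ∀ t, a t = 1 - max (if β < mstar t then (1 : ℝ) else 0) (mstar t))
    (U : Fin K → EuclideanSpace ℝ (Fin d)) (hU : frob U ≤ D) :
    ∑ t : Fin T, ((1 - max (a t) 0) * (if ystar t ≠ y t then (1 : ℝ) else 0)
        + max (a t) 0 * (((K : ℝ) - 1) / K))
      ≤ ∑ t : Fin T, (if ystar t = y t ∧ β < mstar t then (0 : ℝ)
            else max (1 - margin U (x t) (y t)) 0)
        + K ^ 2 * X ^ 2 * frob U ^ 2 / (2 * ((K : ℝ) - 1)) := by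
  have hK' : (2 : ℝ) ≤ K := by exact_mod_cast hK
  have hK0 : (0 : ℝ) < K := by linarith
  have hKβ : ((K : ℝ) - 1) / K = 1 - β := by rw [hβ]; field_simp
  have hβ0 : 0 < β := by rw [hβ]; positivity
  have hβ1 : β < 1 := by rw [hβ, div_lt_one hK0]; linarith
  have hη0 : 0 < η := by rw [hη]; apply div_pos; linarith; positivity
  have hηX : η * X ^ 2 = (1 - β) * β := by rw [hη, hβ]; field_simp
  have hC : (K : ℝ) ^ 2 * X ^ 2 * frob U ^ 2 / (2 * ((K : ℝ) - 1)) = frob U ^ 2 / (2 * η) := by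
    have : (K : ℝ) - 1 ≠ 0 := by linarith
    rw [hη, hβ]; field_simp
  rw [hC, hKβ]
  let Φ : ℕ → ℝ := fun n => (∑ k, ‖W n k - U k‖ ^ 2) / (2 * η)
  have hstep : ∀ t : Fin T, ((1 - max (a t) 0) * (if ystar t ≠ y t then (1 : ℝ) else 0)
        + max (a t) 0 * (1 - β)) ≤ (if ystar t = y t ∧ β < mstar t then (0 : ℝ)
            else max (1 - margin U (x t) (y t)) 0) + (Φ t.1 - Φ (t.1 + 1)) := by
    intro t
    have hproj := projM_le D hD (fun k => W t.1 k - η • g t k) U hU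
    rw [← hWsucc t] at hproj
    obtain ⟨hk1, hk2⟩ := hktil t
    have hm1 : ∀ k, margin (W t.1) (x t) k ≤ mstar t := by
      intro k
      rw [hmstar t]
      exact le_ciSup (Set.finite_range _).bddAbove k
    have hp := (le_margin (W t.1) (x t) (y t) (ktil t) hk1 _ hk2).trans (hm1 _)
    have hm0 : 0 ≤ mstar t := by
      refine le_trans ?_ (hm1 (ystar t))
      have : ∃ k, k ≠ ystar t := by
        by_cases h : y t = ystar t
        · exact ⟨ktil t, h ▸ hk1⟩
        · exact ⟨y t, h⟩
      obtain ⟨k, hk⟩ := this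
      have := le_margin (W t.1) (x t) (ystar t) k hk _ (fun j _ => hystar t j)
      linarith
    have hΦ : Φ t.1 - Φ (t.1 + 1)
        = (∑ k, ‖W t.1 k - U k‖ ^ 2 - ∑ k, ‖W (t.1 + 1) k - U k‖ ^ 2) / (2 * η) := by
      simp only [Φ]; ring
    rw [hΦ]
    by_cases hA : ystar t = y t ∧ β < mstar t
    · have hg0 : g t = 0 := by
        rw [hg t, if_neg]; push Not; exact ⟨hA.2, hA.1⟩
      have ha0 : max (a t) 0 = 0 := by
        apply max_eq_right
        rw [ha t, if_pos hA.2]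
        linarith [le_max_left (1 : ℝ) (mstar t)]
      rw [if_pos hA, ha0, if_neg (not_not.mpr hA.1)]
      simp only [hg0, Pi.zero_apply, smul_zero, sub_zero] at hproj
      have : 0 ≤ (∑ k, ‖W t.1 k - U k‖ ^ 2 - ∑ k, ‖W (t.1 + 1) k - U k‖ ^ 2) / (2 * η) :=
        div_nonneg (by linarith) (by linarith)
      linarith
    · have hgc : mstar t ≤ β ∨ ystar t ≠ y t := by
        by_contra h
        push Not at h
        exact hA ⟨h.2, h.1⟩
      rw [if_neg hA]
      rw [hg t, if_pos hgc, upd_sq _ _ _ _ _ _ hk1] at hproj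
      have hUm := margin_le U (x t) (y t) (ktil t) hk1
      have hl := le_max_left (1 - margin U (x t) (y t)) 0
      have hxx : η * ‖x t‖ ^ 2 ≤ (1 - β) * β := by
        rw [← hηX]
        have := hx t
        gcongr
      have hdiv : ((⟪W t.1 (ktil t), x t⟫ - ⟪U (ktil t), x t⟫)
          - (⟪W t.1 (y t), x t⟫ - ⟪U (y t), x t⟫)) - η * ‖x t‖ ^ 2
          ≤ (∑ k, ‖W t.1 k - U k‖ ^ 2 - ∑ k, ‖W (t.1 + 1) k - U k‖ ^ 2) / (2 * η) := by
        rw [le_div_iff₀ (by linarith)]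
        linarith
      have main : (1 - max (a t) 0) * (if ystar t ≠ y t then (1 : ℝ) else 0)
          + max (a t) 0 * (1 - β)
          ≤ 1 - (⟪W t.1 (y t), x t⟫ - ⟪W t.1 (ktil t), x t⟫) - (1 - β) * β := by
        have haB : mstar t ≤ β → max (a t) 0 = 1 - mstar t := by
          intro h
          rw [ha t, if_neg (not_lt.mpr h), max_eq_right hm0, max_eq_left]
          linarith
        by_cases hys : ystar t = y t
        · have hmb : mstar t ≤ β := by
            rcases hgc with h | h
            · exact h
            · exact absurd hys h
          rw [if_neg (not_not.mpr hys), haB hmb]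
          nlinarith
        · have hmp : mstar t ≤ ⟪W t.1 (ktil t), x t⟫ - ⟪W t.1 (y t), x t⟫ := by
            have h1 := hystar t (y t)
            have h2 := hk2 (ystar t) hys
            rw [hmstar t]
            have : Nonempty (Fin K) := ⟨y t⟩
            apply ciSup_le
            intro k
            by_cases hk : k = y t
            · have := margin_le (W t.1) (x t) (y t) (ktil t) hk1
              rw [hk]
              linarith
            · have := margin_le (W t.1) (x t) k (y t) (Ne.symm hk)
              have := hk2 k hk
              linarith
          rw [if_pos hys]
          by_cases hmb : mstar t ≤ β
          · rw [haB hmb]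
            nlinarith
          · rw [not_le] at hmb
            have ha0 : max (a t) 0 = 0 := by
              apply max_eq_right
              rw [ha t, if_pos hmb]
              linarith [le_max_left (1 : ℝ) (mstar t)]
            rw [ha0]
            nlinarith
      linarith
  have hsum := Finset.sum_le_sum fun t (_ : t ∈ Finset.univ) => hstep t
  rw [Finset.sum_add_distrib] at hsum ⊢
  rw [Finset.sum_add_distrib, Fin.sum_univ_eq_sum_range (fun n => Φ n - Φ (n + 1)),
    Finset.sum_range_sub'] at hsum
  have h0 : Φ 0 = frob U ^ 2 / (2 * η) := by
    simp [Φ, hW0, frob_sq]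
  have hT : 0 ≤ Φ T := div_nonneg (Finset.sum_nonneg fun _ _ => sq_nonneg _) (by linarith)
  linarith
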